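/- Let J be a real n × m matrix, κ, τ > 0, and v ∈ ℝ^m. Then ‖(κ JᵀJ + τ I)^{-1} Jᵀ v‖₂ ≤ (1/(2√(κτ))) ‖v‖₂. -/

import Mathlib

open Matrix

/-- The Tikhonov-regularized Gram matrix `κ JᵀJ + τI` is positive definite. -/
lemma posDef_smul_transpose_mul_self_add_smul_one
    {n m : ℕ} (J : Matrix (Fin n) (Fin m) ℝ) {κ τ : ℝ} (hκ : 0 < κ) (hτ : 0 < τ) :
    (κ • (Jᵀ * J) + τ • (1 : Matrix (Fin m) (Fin m) ℝ)).PosDef := by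
  have hJ : (Jᵀ * J).PosSemidef := by
    simpa using Matrix.posSemidef_conjTranspose_mul_self J
  exact Matrix.PosDef.posSemidef_add (hJ.smul hκ.le) (Matrix.PosDef.one.smul hτ)

/-- A solution `w` of the regularized normal equations satisfies `4κτ‖w‖² ≤ ‖v‖²`. -/
lemma dotProduct_self_le_of_regularized_normal_equations
    {n m : ℕ} (J : Matrix (Fin n) (Fin m) ℝ) {κ τ : ℝ}
    {v : Fin n → ℝ} {w : Fin m → ℝ}
    (hw : (κ • (Jᵀ * J) + τ • (1 : Matrix (Fin m) (Fin m) ℝ)) *ᵥ w = Jᵀ *ᵥ v) :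
    4 * (κ * τ) * (w ⬝ᵥ w) ≤ v ⬝ᵥ v := by
  have transpose_dot (u : Fin n → ℝ) : w ⬝ᵥ (Jᵀ *ᵥ u) = (J *ᵥ w) ⬝ᵥ u := by
    rw [dotProduct_mulVec, vecMul_transpose]
  have energy : κ * ((J *ᵥ w) ⬝ᵥ (J *ᵥ w)) + τ * (w ⬝ᵥ w) = (J *ᵥ w) ⬝ᵥ v := by
    have h := congrArg (w ⬝ᵥ ·) hw
    simpa [add_mulVec, smul_mulVec, ← mulVec_mulVec, transpose_dot] using h
  have square : 0 ≤ ((2 * κ) • (J *ᵥ w) - v) ⬝ᵥ ((2 * κ) • (J *ᵥ w) - v) :=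
    Finset.sum_nonneg fun i _ => mul_self_nonneg _
  simp only [sub_dotProduct, dotProduct_sub, smul_dotProduct, dotProduct_smul, smul_eq_mul,
    dotProduct_comm v (J *ᵥ w)] at square
  linear_combination square + 4 * κ * energy

/-- Tikhonov-regularized natural-gradient boundedness lemma:
`‖(κ JᵀJ + τI)⁻¹ Jᵀ v‖₂ ≤ ‖v‖₂ / (2√(κτ))`. -/
theorem tikhonov_preconditioner_bound
    {n m : ℕ} (J : Matrix (Fin n) (Fin m) ℝ)
    (κ τ : ℝ) (hκ : 0 < κ) (hτ : 0 < τ) (v : Fin n → ℝ) :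
    Real.sqrt (∑ i, ((κ • (Jᵀ * J) + τ • (1 : Matrix (Fin m) (Fin m) ℝ))⁻¹.mulVec
        (Jᵀ.mulVec v) i)^2)
      ≤ (1 / (2 * Real.sqrt (κ * τ))) * Real.sqrt (∑ i, (v i)^2) := by
  set A := κ • (Jᵀ * J) + τ • (1 : Matrix (Fin m) (Fin m) ℝ)
  have hdet : IsUnit A.det :=
    (posDef_smul_transpose_mul_self_add_smul_one J hκ hτ).det_pos.ne'.isUnit
  have hw : A *ᵥ (A⁻¹ *ᵥ (Jᵀ *ᵥ v)) = Jᵀ *ᵥ v := by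
    rw [mulVec_mulVec, mul_nonsing_inv _ hdet, one_mulVec]
  have bound := dotProduct_self_le_of_regularized_normal_equations J hw
  simp only [dotProduct, ← sq] at bound
  have hs : 0 < Real.sqrt (κ * τ) := Real.sqrt_pos.2 (mul_pos hκ hτ)
  rw [one_div_mul_eq_div, le_div_iff₀ (by positivity)]
  apply Real.le_sqrt_of_sq_le
  rw [mul_pow, mul_pow, Real.sq_sqrt (Finset.sum_nonneg fun i _ => sq_nonneg _),
    Real.sq_sqrt (mul_pos hκ hτ).le]
  linarith
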